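/- Let m ≥ 1, let 0 < α_1 < α_2 < ... < α_m be real numbers and let c_1, ..., c_m be positive real numbers. Define F(λ) = 1 + Σ_{j=1}^m c_j α_j/(α_j − λ) for λ ∈ ℝ \ {α_1, ..., α_m}. Then the zero set {λ ∈ ℝ \ {α_1, ..., α_m} : F(λ) = 0} has exactly m elements, and when these zeros are enumerated in ascending order as β_1 < β_2 < ... < β_m, they interlace with the poles: α_j < β_j < α_{j+1} for every j ∈ {1, ..., m−1}, and α_m < β_m < ∞. -/

import Mathlib

open Filter Topology

lemma F_aux_mono {m : ℕ} (hm : 1 ≤ m) (α a : Fin m → ℝ) (ha : ∀ j, 0 < a j) {x y : ℝ}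
    (hxy : x < y) (h : ∀ i, α i < x ∨ y < α i) :
    1 + ∑ i, a i / (α i - x) < 1 + ∑ i, a i / (α i - y) := by
  have : Nonempty (Fin m) := ⟨⟨0, hm⟩⟩
  gcongr 1 + ?_
  refine Finset.sum_lt_sum_of_nonempty Finset.univ_nonempty fun i _ => ?_
  rcases h i with h | h
  · have h1 : a i / (x - α i) > a i / (y - α i) :=
      div_lt_div_of_pos_left (ha i) (by linarith) (by linarith)
    rw [← neg_sub x, ← neg_sub y, div_neg, div_neg]
    linarith
  · exact div_lt_div_of_pos_left (ha i) (by linarith) (by linarith)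

lemma F_aux_split {m : ℕ} (α a : Fin m → ℝ) (j : Fin m) :
    (fun x => 1 + ∑ i, a i / (α i - x)) =
      fun x => a j * (α j - x)⁻¹ + (1 + ∑ i ∈ Finset.univ.erase j, a i / (α i - x)) := by
  funext x
  rw [← Finset.add_sum_erase Finset.univ _ (Finset.mem_univ j)]
  ring

lemma F_aux_rest {m : ℕ} (α a : Fin m → ℝ) (hα : StrictMono α) (j : Fin m) :
    Tendsto (fun x => 1 + ∑ i ∈ Finset.univ.erase j, a i / (α i - x)) (𝓝 (α j))
      (𝓝 (1 + ∑ i ∈ Finset.univ.erase j, a i / (α i - α j))) := by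
  refine tendsto_const_nhds.add (tendsto_finsetSum _ fun i hi => ?_)
  refine tendsto_const_nhds.div (tendsto_const_nhds.sub tendsto_id) ?_
  exact sub_ne_zero.2 fun h => (Finset.ne_of_mem_erase hi) (hα.injective h)

lemma F_aux_right {m : ℕ} (α a : Fin m → ℝ) (hα : StrictMono α) (ha : ∀ j, 0 < a j) (j : Fin m) :
    Tendsto (fun x => 1 + ∑ i, a i / (α i - x)) (𝓝[>] (α j)) atBot := by
  rw [F_aux_split α a j]
  refine Tendsto.atBot_add ?_ ((F_aux_rest α a hα j).mono_left nhdsWithin_le_nhds)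
  refine Tendsto.const_mul_atBot (ha j) ?_
  refine tendsto_inv_nhdsLT_zero.comp (tendsto_nhdsWithin_iff.2 ⟨?_, ?_⟩)
  · have : Tendsto (fun x => α j - x) (𝓝 (α j)) (𝓝 (α j - α j)) :=
      tendsto_const_nhds.sub tendsto_id
    rw [sub_self] at this
    exact this.mono_left nhdsWithin_le_nhds
  · filter_upwards [self_mem_nhdsWithin] with x hx
    exact sub_neg.2 (Set.mem_Ioi.1 hx)

lemma F_aux_left {m : ℕ} (α a : Fin m → ℝ) (hα : StrictMono α) (ha : ∀ j, 0 < a j) (j : Fin m) :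
    Tendsto (fun x => 1 + ∑ i, a i / (α i - x)) (𝓝[<] (α j)) atTop := by
  rw [F_aux_split α a j]
  refine Tendsto.atTop_add ?_ ((F_aux_rest α a hα j).mono_left nhdsWithin_le_nhds)
  refine Tendsto.const_mul_atTop (ha j) ?_
  refine tendsto_inv_nhdsGT_zero.comp (tendsto_nhdsWithin_iff.2 ⟨?_, ?_⟩)
  · have : Tendsto (fun x => α j - x) (𝓝 (α j)) (𝓝 (α j - α j)) :=
      tendsto_const_nhds.sub tendsto_id
    rw [sub_self] at this
    exact this.mono_left nhdsWithin_le_nhds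
  · filter_upwards [self_mem_nhdsWithin] with x hx
    exact sub_pos.2 (Set.mem_Iio.1 hx)

lemma F_aux_top {m : ℕ} (α a : Fin m → ℝ) :
    Tendsto (fun x => 1 + ∑ i, a i / (α i - x)) atTop (𝓝 1) := by
  have : Tendsto (fun x => 1 + ∑ i, a i / (α i - x)) atTop (𝓝 (1 + ∑ _i : Fin m, 0)) := by
    refine tendsto_const_nhds.add (tendsto_finsetSum _ fun i _ => ?_)
    refine Tendsto.div_atBot tendsto_const_nhds ?_
    change Tendsto (fun x => α i + -x) atTop atBot
    exact tendsto_atBot_add_const_left _ _ tendsto_neg_atTop_atBot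
  simpa using this

lemma F_aux_exists {m : ℕ} (α a : Fin m → ℝ) (hα : StrictMono α) (ha : ∀ j, 0 < a j)
    (j : Fin m) :
    ∃ x, (α j < x ∧ ∀ i, j < i → x < α i) ∧ 1 + ∑ i, a i / (α i - x) = 0 := by
  set S : Set ℝ := {x | α j < x ∧ ∀ i, j < i → x < α i} with hS
  have hconn : S.OrdConnected := ⟨fun x hx y hy z hz =>
    ⟨hx.1.trans_le hz.1, fun i hi => hz.2.trans_lt (hy.2 i hi)⟩⟩
  have hcont : ContinuousOn (fun x => 1 + ∑ i, a i / (α i - x)) S := by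
    refine continuousOn_const.add (continuousOn_finsetSum _ fun i _ => ?_)
    refine continuousOn_const.div (continuousOn_const.sub continuousOn_id) fun x hx => ?_
    rcases le_or_gt i j with h | h
    · have := hα.monotone h
      have := hx.1
      change α i - x ≠ 0
      exact ne_of_lt (by linarith)
    · have := hx.2 i h
      change α i - x ≠ 0
      exact ne_of_gt (by linarith)
  have h1 : ∃ x ∈ S, 1 + ∑ i, a i / (α i - x) ≤ 0 := by
    have e1 := (F_aux_right α a hα ha j).eventually_le_atBot 0
    have e2 : ∀ᶠ x in 𝓝[>] (α j), ∀ i, j < i → x < α i := by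
      refine eventually_all.2 fun i => ?_
      by_cases hi : j < i
      · filter_upwards [nhdsWithin_le_nhds (Iio_mem_nhds (hα hi))] with x hx _
        exact hx
      · simp [hi]
    obtain ⟨x, h1, h2, h3⟩ := (e1.and (e2.and self_mem_nhdsWithin)).exists
    exact ⟨x, ⟨h3, h2⟩, h1⟩
  have h2 : ∃ x ∈ S, 0 ≤ 1 + ∑ i, a i / (α i - x) := by
    by_cases hj : (j : ℕ) + 1 < m
    · have hlt : j < ⟨(j : ℕ) + 1, hj⟩ := Fin.lt_def.2 (Nat.lt_succ_self _)
      have e1 := (F_aux_left α a hα ha ⟨(j : ℕ) + 1, hj⟩).eventually_ge_atTop 0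
      have e2 := nhdsWithin_le_nhds (s := Set.Iio (α ⟨(j : ℕ) + 1, hj⟩)) (Ioi_mem_nhds (hα hlt))
      obtain ⟨x, ⟨h1, h2⟩, h3⟩ := ((e1.and e2).and self_mem_nhdsWithin).exists
      refine ⟨x, ⟨h2, fun i hi => lt_of_lt_of_le h3 (hα.monotone ?_)⟩, h1⟩
      exact Fin.le_def.2 (Nat.succ_le_of_lt hi)
    · have e1 := (F_aux_top α a).eventually (lt_mem_nhds one_pos)
      obtain ⟨x, h1, h2⟩ := (e1.and (eventually_gt_atTop (α j))).exists
      refine ⟨x, ⟨h2, fun i hi => ?_⟩, h1.le⟩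
      have := i.2
      have := Fin.lt_def.1 hi
      omega
  obtain ⟨x, hx, hx0⟩ := h1
  obtain ⟨y, hy, hy0⟩ := h2
  obtain ⟨z, hz, hz0⟩ := hconn.isPreconnected.intermediate_value hx hy hcont ⟨hx0, hy0⟩
  exact ⟨z, hz, hz0⟩

theorem F_zeros_interlace_with_poles
    (m : ℕ) (hm : 1 ≤ m) (α c : Fin m → ℝ)
    (hαpos : ∀ j, 0 < α j) (hαmono : StrictMono α) (hcpos : ∀ j, 0 < c j) :
    {lam : ℝ | (∀ j, lam ≠ α j) ∧ 1 + ∑ i, c i * α i / (α i - lam) = 0}.ncard = m ∧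
    ∃ β : Fin m → ℝ, StrictMono β ∧
      Set.range β =
        {lam : ℝ | (∀ j, lam ≠ α j) ∧ 1 + ∑ i, c i * α i / (α i - lam) = 0} ∧
      (∀ j, α j < β j) ∧
      (∀ (j : Fin m) (hj : (j : ℕ) + 1 < m), β j < α ⟨(j : ℕ) + 1, hj⟩) := by
  have ha : ∀ j, 0 < c j * α j := fun j => mul_pos (hcpos j) (hαpos j)
  choose β hβ hβ0 using F_aux_exists α (fun j => c j * α j) hαmono ha
  have hmono : StrictMono β := fun i j hij => ((hβ i).2 j hij).trans (hβ j).1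
  have hrange : Set.range β =
      {lam : ℝ | (∀ j, lam ≠ α j) ∧ 1 + ∑ i, c i * α i / (α i - lam) = 0} := by
    ext x
    constructor
    · rintro ⟨j, rfl⟩
      refine ⟨fun i => ?_, hβ0 j⟩
      rcases le_or_gt i j with h | h
      · exact ((hαmono.monotone h).trans_lt (hβ j).1).ne'
      · exact ((hβ j).2 i h).ne
    · rintro ⟨hne, h0⟩
      by_cases hex : ∃ j, α j < x
      · obtain ⟨j, hj, hmax⟩ := (Set.toFinite {j | α j < x}).exists_maximal hex
        have hgt : ∀ i, j < i → x < α i := fun i hi => by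
          by_contra hcon
          have hlt : α i < x := lt_of_le_of_ne (not_lt.1 hcon) (hne i).symm
          exact absurd (hmax hlt hi.le) (not_le.2 hi)
        refine ⟨j, ?_⟩
        rcases lt_trichotomy (β j) x with h | h | h
        · have := F_aux_mono hm α _ ha h fun i => by
            rcases le_or_gt i j with h | h
            · exact Or.inl ((hαmono.monotone h).trans_lt (hβ j).1)
            · exact Or.inr (hgt i h)
          have := hβ0 j
          linarith
        · exact h
        · have := F_aux_mono hm α _ ha h fun i => by
            rcases le_or_gt i j with h | h
            · exact Or.inl ((hαmono.monotone h).trans_lt hj)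
            · exact Or.inr ((hβ j).2 i h)
          have := hβ0 j
          linarith
      · push Not at hex
        have : 0 ≤ ∑ i, c i * α i / (α i - x) :=
          Finset.sum_nonneg fun i _ => div_nonneg (ha i).le (sub_nonneg.2 (hex i))
        linarith
  refine ⟨?_, β, hmono, hrange, fun j => (hβ j).1, fun j hj => (hβ j).2 _ ?_⟩
  · rw [← hrange, ← Set.image_univ, Set.ncard_image_of_injective _ hmono.injective,
      Set.ncard_univ, Nat.card_fin]
  · exact Fin.lt_def.2 (Nat.lt_succ_self _)
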